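/- arXiv:1801.09874 — 2 statements merged into one kernel-verified Lean document; each statement's English description precedes it below -/
import Mathlib

section
/- Suppose (μ, m) has critical root structure with roots 0 < t_1 < … < t_k < 1 of orders v_1, …, v_k, and set v = max_{1 ≤ l ≤ k} v_l. Let K_d : ℝ → ℝ be continuous and even with support contained in [−1,1]. Then lim_{h → 0⁺} h^{−1/(v+1)} · ∫_0^1 K_d((μ(t) − m)/h) dt = ((v+1)!)^{1/(v+1)} · (Σ_{l : v_l = v} |μ^{(v_l+1)}(t_l)|^{−1/(v+1)}) · ∫_{−1}^{1} K_d(z^{v+1}) dz. -/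
open MeasureTheory Set

/-- The extended root sequence: `t₀ = 0`, `t_{k+1} = 1`, and the given roots in between. -/
noncomputable def extRoots (k : ℕ) (t : ℕ → ℝ) : ℕ → ℝ :=
  fun i => if i = 0 then 0 else if i ≤ k then t i else 1

/-- `(μ, m)` has critical root structure with roots `0 < t 1 < … < t k < 1` of orders
`v 1, …, v k` and gap parameter `γ = (1/2)·min_{0 ≤ i ≤ k} (t_{i+1} - t_i)`
(with the convention `t 0 = 0`, `t (k+1) = 1`). -/
structure CriticalRootStructure (μ : ℝ → ℝ) (m : ℝ) (k : ℕ) (t : ℕ → ℝ)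
    (v : ℕ → ℕ) (γ : ℝ) : Prop where
  k_pos : 0 < k
  mono : ∀ i j, 1 ≤ i → i < j → j ≤ k → t i < t j
  first_pos : 0 < t 1
  last_lt : t k < 1
  gamma_eq : γ = (1 / 2) * ((Finset.Icc 0 k).inf' (Finset.nonempty_Icc.mpr (Nat.zero_le k))
      fun i => extRoots k t (i + 1) - extRoots k t i)
  root : ∀ l, 1 ≤ l → l ≤ k → μ (t l) = m
  -- (i) μ is (v l + 1)-times differentiable on [t l - γ, t l + γ] ...
  diffble : ∀ l, 1 ≤ l → l ≤ k → ∀ j ≤ v l,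
      DifferentiableOn ℝ (iteratedDerivWithin j μ (Icc (t l - γ) (t l + γ)))
        (Icc (t l - γ) (t l + γ))
  -- ... with μ^{(j)}(t l) = 0 for 1 ≤ j ≤ v l ...
  deriv_zero : ∀ l, 1 ≤ l → l ≤ k → ∀ j, 1 ≤ j → j ≤ v l →
      iteratedDerivWithin j μ (Icc (t l - γ) (t l + γ)) (t l) = 0
  -- ... μ^{(v l + 1)}(t l) ≠ 0 ...
  deriv_ne : ∀ l, 1 ≤ l → l ≤ k →
      iteratedDerivWithin (v l + 1) μ (Icc (t l - γ) (t l + γ)) (t l) ≠ 0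
  -- ... and μ^{(v l + 1)} Lipschitz continuous on [t l - γ, t l + γ].
  deriv_lip : ∀ l, 1 ≤ l → l ≤ k → ∃ C : NNReal,
      LipschitzOnWith C (iteratedDerivWithin (v l + 1) μ (Icc (t l - γ) (t l + γ)))
        (Icc (t l - γ) (t l + γ))
  -- (ii) μ strictly monotone on [t l - γ, t l] and on [t l, t l + γ].
  mono_left : ∀ l, 1 ≤ l → l ≤ k →
      StrictMonoOn μ (Icc (t l - γ) (t l)) ∨ StrictAntiOn μ (Icc (t l - γ) (t l))
  mono_right : ∀ l, 1 ≤ l → l ≤ k →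
      StrictMonoOn μ (Icc (t l) (t l + γ)) ∨ StrictAntiOn μ (Icc (t l) (t l + γ))
  -- (iii) |μ - m| bounded away from 0 outside the γ-neighbourhoods of the roots.
  sep : ∃ ε > 0, ∀ s ∈ Icc (0:ℝ) 1,
      (∀ l, 1 ≤ l → l ≤ k → γ < |s - t l|) → ε ≤ |μ s - m|

open Filter Topology

theorem integral_comp_const_mul_pow {K : ℝ → ℝ} (hKe : ∀ x, K (-x) = K x)
    (hKs : Function.support K ⊆ Icc (-1 : ℝ) 1) {n : ℕ} (hn : n ≠ 0) {b : ℝ} (hb : b ≠ 0) :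
    ∫ u, K (b * u ^ n) = |b| ^ (-(1 : ℝ) / n) * ∫ z in Icc (-1 : ℝ) 1, K (z ^ n) := by
  have hb' : 0 < |b| := abs_pos.mpr hb
  have habs : ∀ x, K |x| = K x := fun x => by
    rcases abs_choice x with h | h <;> simp [h, hKe]
  have hscale : ∀ u, K (b * u ^ n) = K ((|b| ^ ((1 : ℝ) / n) * u) ^ n) := fun u => by
    rw [mul_pow, one_div, Real.rpow_inv_natCast_pow hb'.le hn, ← habs, ← habs (|b| * _)]
    simp [abs_mul]
  simp_rw [hscale]
  rw [Measure.integral_comp_mul_left (fun z => K (z ^ n)), abs_inv,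
    abs_of_nonneg (by positivity), ← Real.rpow_neg hb'.le, neg_div, smul_eq_mul,
    setIntegral_eq_integral_of_forall_compl_eq_zero]
  intro z hz
  by_contra h
  have h1 := abs_le.mpr (mem_Icc.mp (hKs h))
  rw [abs_pow, pow_le_one_iff_of_nonneg (abs_nonneg z) hn] at h1
  exact hz (abs_le.mp h1)

/-- Laplace-type asymptotic at a single zero of exact order `n`. -/
theorem tendsto_rpow_mul_setIntegral_comp_div {K : ℝ → ℝ} (hKc : Continuous K)
    (hKe : ∀ x, K (-x) = K x) (hKs : Function.support K ⊆ Icc (-1 : ℝ) 1)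
    {f q : ℝ → ℝ} {p δ : ℝ} (hδ : 0 < δ) {n : ℕ} (hn : n ≠ 0)
    (hq : ContinuousOn q (Icc (p - δ) (p + δ))) (hq0 : ∀ x ∈ Icc (p - δ) (p + δ), q x ≠ 0)
    (hf : ∀ x ∈ Icc (p - δ) (p + δ), f x = q x * (x - p) ^ n) :
    Tendsto (fun h : ℝ => h ^ (-(1 : ℝ) / n) * ∫ x in Ioc (p - δ) (p + δ), K (f x / h)) (𝓝[>] 0)
      (𝓝 (|q p| ^ (-(1 : ℝ) / n) * ∫ z in Icc (-1 : ℝ) 1, K (z ^ n))) := by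
  have hp : p ∈ Icc (p - δ) (p + δ) := ⟨by linarith, by linarith⟩
  obtain ⟨x₀, hx₀, hmin⟩ := isCompact_Icc.exists_isMinOn ⟨p, hp⟩ hq.abs
  have hc : 0 < |q x₀| := abs_pos.mpr (hq0 x₀ hx₀)
  set c := |q x₀|
  obtain ⟨M, hM⟩ : ∃ M, ∀ x, ‖K x‖ ≤ M :=
    hKc.bounded_above_of_compact_support
      (HasCompactSupport.of_support_subset_isCompact isCompact_Icc hKs)
  have hM0 : 0 ≤ M := (norm_nonneg _).trans (hM 0)
  set I := Ioc (p - δ) (p + δ)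
  set F : ℝ → ℝ → ℝ := fun h => I.indicator fun x => K (f x / h)
  have hs : Tendsto (fun h : ℝ => h ^ ((1 : ℝ) / n)) (𝓝[>] 0) (𝓝 0) := by
    have : ContinuousAt (fun h : ℝ => h ^ ((1 : ℝ) / n)) 0 :=
      Real.continuousAt_rpow_const _ _ (Or.inr (by positivity))
    have h0 : (0 : ℝ) ^ ((1 : ℝ) / n) = 0 := Real.zero_rpow (by positivity)
    rw [ContinuousAt, h0] at this
    exact this.mono_left nhdsWithin_le_nhds
  have hscale : ∀ h : ℝ, 0 < h → h ^ (-(1 : ℝ) / n) * ∫ x in I, K (f x / h) =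
      ∫ u, F h (p + h ^ ((1 : ℝ) / n) * u) := fun h hh => by
    rw [Measure.integral_comp_mul_left (fun y => F h (p + y)), integral_add_left_eq_self,
      abs_inv, abs_of_nonneg (by positivity), ← Real.rpow_neg hh.le, neg_div, smul_eq_mul,
      integral_indicator measurableSet_Ioc]
  have hpow : ∀ h : ℝ, 0 < h → (h ^ ((1 : ℝ) / n)) ^ n = h := fun h hh => by
    rw [one_div, Real.rpow_inv_natCast_pow hh.le hn]
  have hval : ∀ h u : ℝ, 0 < h → p + h ^ ((1 : ℝ) / n) * u ∈ I →
      F h (p + h ^ ((1 : ℝ) / n) * u) = K (q (p + h ^ ((1 : ℝ) / n) * u) * u ^ n) := by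
    intro h u hh hx
    simp only [F, indicator_of_mem hx]
    rw [hf _ (Ioc_subset_Icc_self hx), add_sub_cancel_left, mul_pow, hpow h hh]
    congr 1
    field_simp
  rw [← integral_comp_const_mul_pow hKe hKs hn (hq0 p hp)]
  refine Tendsto.congr' (eventually_mem_nhdsWithin.mono fun h hh => (hscale h hh).symm) ?_
  refine tendsto_integral_filter_of_dominated_convergence
    ((Icc (-(1 + c⁻¹)) (1 + c⁻¹)).indicator fun _ => M) ?_ ?_ ?_ ?_
  · filter_upwards [self_mem_nhdsWithin] with h hh
    have hfc : ContinuousOn f (Icc (p - δ) (p + δ)) :=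
      ContinuousOn.congr (hq.mul (by fun_prop)) hf
    have hFm : Measurable (F h) := by
      simp only [F, ← piecewise_eq_indicator]
      exact ContinuousOn.measurable_piecewise
        (hKc.comp_continuousOn ((hfc.mono Ioc_subset_Icc_self).div_const h))
        continuousOn_const measurableSet_Ioc
    exact (hFm.comp (by fun_prop)).aestronglyMeasurable
  · filter_upwards [self_mem_nhdsWithin] with h hh
    refine Eventually.of_forall fun u => ?_
    by_cases hx : p + h ^ ((1 : ℝ) / n) * u ∈ I
    swap
    · simp only [F, indicator_of_notMem hx, norm_zero]
      exact indicator_nonneg (fun _ _ => hM0) _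
    by_cases hu : u ∈ Icc (-(1 + c⁻¹)) (1 + c⁻¹)
    · rw [hval h u hh hx, indicator_of_mem hu]
      exact hM _
    · rw [hval h u hh hx, indicator_of_notMem hu, norm_le_zero_iff]
      by_contra hne
      have h1 := abs_le.mpr (mem_Icc.mp (hKs hne))
      have hcq : c ≤ |q (p + h ^ ((1 : ℝ) / n) * u)| := hmin (Ioc_subset_Icc_self hx)
      have hu' : 1 + c⁻¹ < |u| := by
        by_contra! hle
        exact hu (abs_le.mp hle)
      have hc' : 0 < c⁻¹ := inv_pos.mpr hc
      have hu1 : |u| ≤ |u| ^ n := le_self_pow₀ (by linarith) hn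
      rw [abs_mul, abs_pow] at h1
      have h2 : c * (1 + c⁻¹) ≤ 1 :=
        (mul_le_mul hcq (hu'.le.trans hu1) (by positivity) (abs_nonneg _)).trans h1
      rw [mul_add, mul_inv_cancel₀ hc.ne'] at h2
      linarith
  · exact (integrable_indicator_iff measurableSet_Icc).mpr (by simp)
  · refine Eventually.of_forall fun u => ?_
    have hx : Tendsto (fun h : ℝ => p + h ^ ((1 : ℝ) / n) * u) (𝓝[>] 0) (𝓝 p) := by
      simpa using (hs.mul_const u).const_add p
    have hqp : ContinuousAt q p := hq.continuousAt (Icc_mem_nhds (by linarith) (by linarith))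
    have hlim := (hKc.tendsto _).comp ((hqp.tendsto.comp hx).mul_const (u ^ n))
    refine hlim.congr' ?_
    filter_upwards [self_mem_nhdsWithin,
      hx.eventually (Ioc_mem_nhds (by linarith : p - δ < p) (by linarith : p < p + δ))]
      with h hh hxI
    exact (hval h u hh hxI).symm

/-- A `C^n` function with an isolated zero of exact order `n` factors as `q x * (x - p) ^ n` with `q`
continuous and nonvanishing. -/
theorem exists_continuousOn_eq_mul_pow {f : ℝ → ℝ} {p δ : ℝ} (hδ : 0 < δ) {n : ℕ} (hn : n ≠ 0)
    (hf : ContDiffOn ℝ n f (Icc (p - δ) (p + δ)))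
    (hz : ∀ j < n, iteratedDerivWithin j f (Icc (p - δ) (p + δ)) p = 0)
    (hne : iteratedDerivWithin n f (Icc (p - δ) (p + δ)) p ≠ 0)
    (hf0 : ∀ x ∈ Icc (p - δ) (p + δ), x ≠ p → f x ≠ 0) :
    ∃ q : ℝ → ℝ, ContinuousOn q (Icc (p - δ) (p + δ)) ∧
      (∀ x ∈ Icc (p - δ) (p + δ), q x ≠ 0) ∧
      (∀ x ∈ Icc (p - δ) (p + δ), f x = q x * (x - p) ^ n) ∧
      q p = (n.factorial : ℝ)⁻¹ * iteratedDerivWithin n f (Icc (p - δ) (p + δ)) p := by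
  have hp : p ∈ Icc (p - δ) (p + δ) := ⟨by linarith, by linarith⟩
  set I := Icc (p - δ) (p + δ)
  set a := iteratedDerivWithin n f I p
  refine ⟨Function.update (fun x => f x / (x - p) ^ n) p ((n.factorial : ℝ)⁻¹ * a),
    ?_, ?_, ?_, by simp⟩
  · rw [continuousOn_update_iff]
    refine ⟨(hf.continuousOn.mono sdiff_subset).div (by fun_prop) fun x hx =>
      pow_ne_zero _ (sub_ne_zero.mpr hx.2), fun _ => ?_⟩
    have htaylor := (taylor_tendsto (convex_Icc _ _) hp hf).mono_left
      (nhdsWithin_mono p (sdiff_subset : I \ {p} ⊆ I))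
    have h := htaylor.add_const ((n.factorial : ℝ)⁻¹ * a)
    rw [zero_add] at h
    refine h.congr' (eventually_mem_nhdsWithin.mono fun x hx => ?_)
    have hxp : (x - p) ^ n ≠ 0 := pow_ne_zero _ (sub_ne_zero.mpr hx.2)
    have hsum : taylorWithinEval f n I p x = (n.factorial : ℝ)⁻¹ * (x - p) ^ n * a := by
      rw [taylor_within_apply, Finset.sum_range_succ, Finset.sum_eq_zero, zero_add, smul_eq_mul]
      intro j hj
      rw [hz j (Finset.mem_range.mp hj), smul_zero]
    rw [hsum, smul_eq_mul]
    field_simp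
    ring
  · intro x hx
    rcases eq_or_ne x p with rfl | hxp
    · simpa [Nat.factorial_ne_zero] using hne
    · rw [Function.update_of_ne hxp]
      exact div_ne_zero (hf0 x hx hxp) (pow_ne_zero _ (sub_ne_zero.mpr hxp))
  · intro x hx
    rcases eq_or_ne x p with rfl | hxp
    · simpa [hn] using hz 0 (Nat.pos_of_ne_zero hn)
    · rw [Function.update_of_ne hxp, div_mul_cancel₀ _ (pow_ne_zero _ (sub_ne_zero.mpr hxp))]

theorem iteratedDerivWithin_sub_const {f : ℝ → ℝ} {s : Set ℝ} {j : ℕ} (hj : 0 < j) (c x : ℝ) :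
    iteratedDerivWithin j (fun y => f y - c) s x = iteratedDerivWithin j f s x := by
  simp_rw [sub_eq_neg_add]
  exact iteratedDerivWithin_const_add hj (-c)

namespace CriticalRootStructure

variable {μ : ℝ → ℝ} {m : ℝ} {k : ℕ} {t : ℕ → ℝ} {v : ℕ → ℕ} {γ : ℝ}

theorem two_mul_gamma_le (hcrs : CriticalRootStructure μ m k t v γ) {i : ℕ} (hi : i ≤ k) :
    2 * γ ≤ extRoots k t (i + 1) - extRoots k t i := by
  have h := Finset.inf'_le (fun i => extRoots k t (i + 1) - extRoots k t i)
    (Finset.mem_Icc.mpr ⟨Nat.zero_le i, hi⟩)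
  have hγ := hcrs.gamma_eq
  linarith

theorem gamma_pos (hcrs : CriticalRootStructure μ m k t v γ) : 0 < γ := by
  rw [hcrs.gamma_eq]
  refine mul_pos (by norm_num) ((Finset.lt_inf'_iff _).mpr fun i hi => ?_)
  have hik := (Finset.mem_Icc.mp hi).2
  have hk := hcrs.k_pos
  rcases Nat.eq_zero_or_pos i with rfl | hi0
  · simpa [extRoots, Nat.one_le_iff_ne_zero.mpr hk.ne'] using hcrs.first_pos
  · rcases hik.eq_or_lt with rfl | hlt
    · simpa [extRoots, hi0.ne'] using hcrs.last_lt
    · simpa [extRoots, hi0.ne', hik, Nat.succ_le_of_lt hlt] using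
        hcrs.mono i (i + 1) hi0 i.lt_succ_self hlt

theorem add_gamma_le_sub_gamma (hcrs : CriticalRootStructure μ m k t v γ) {i j : ℕ}
    (hi : 1 ≤ i) (hij : i < j) (hj : j ≤ k) : t i + γ ≤ t j - γ := by
  have h := hcrs.two_mul_gamma_le (i := i) (hij.le.trans hj)
  have hle : t (i + 1) ≤ t j := by
    rcases (Nat.succ_le_of_lt hij).eq_or_lt with rfl | hlt
    · exact le_rfl
    · exact (hcrs.mono _ _ (by omega) hlt hj).le
  simp only [extRoots, show i + 1 ≠ 0 by omega, show i ≠ 0 by omega, show i + 1 ≤ k by omega,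
    show i ≤ k by omega, if_true, if_false] at h
  linarith

theorem Icc_subset (hcrs : CriticalRootStructure μ m k t v γ) {l : ℕ} (h1 : 1 ≤ l) (hk : l ≤ k) :
    Icc (t l - γ) (t l + γ) ⊆ Icc 0 1 := by
  have hγ := hcrs.gamma_pos
  have hfirst := hcrs.two_mul_gamma_le (i := 0) (Nat.zero_le k)
  have hlast := hcrs.two_mul_gamma_le (i := k) le_rfl
  have hk0 := hcrs.k_pos
  simp only [extRoots, zero_add, one_ne_zero, show 1 ≤ k by omega, if_true, if_false] at hfirst
  simp only [extRoots, show k + 1 ≠ 0 by omega, show ¬ k + 1 ≤ k by omega, show k ≠ 0 by omega,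
    le_refl, if_true, if_false] at hlast
  have hl1 : t 1 ≤ t l := by
    rcases h1.eq_or_lt with rfl | hlt
    · exact le_rfl
    · exact (hcrs.mono _ _ le_rfl hlt hk).le
  have hlk : t l ≤ t k := by
    rcases hk.eq_or_lt with rfl | hlt
    · exact le_rfl
    · exact (hcrs.mono _ _ h1 hlt le_rfl).le
  exact Icc_subset_Icc (by linarith) (by linarith)

theorem contDiffOn (hcrs : CriticalRootStructure μ m k t v γ) {l : ℕ} (h1 : 1 ≤ l) (hk : l ≤ k) :
    ContDiffOn ℝ ((v l + 1 : ℕ) : WithTop ℕ∞) μ (Icc (t l - γ) (t l + γ)) := by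
  have hγ := hcrs.gamma_pos
  rw [contDiffOn_nat_iff_continuousOn_differentiableOn_deriv (uniqueDiffOn_Icc (by linarith))]
  refine ⟨fun j hj => ?_, fun j hj => hcrs.diffble l h1 hk j (Nat.lt_succ_iff.mp hj)⟩
  rcases hj.eq_or_lt with rfl | hlt
  · obtain ⟨C, hC⟩ := hcrs.deriv_lip l h1 hk
    exact hC.continuousOn
  · exact (hcrs.diffble l h1 hk j (Nat.lt_succ_iff.mp hlt)).continuousOn

theorem ne_of_ne_root (hcrs : CriticalRootStructure μ m k t v γ) {l : ℕ} (h1 : 1 ≤ l)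
    (hk : l ≤ k) {x : ℝ} (hx : x ∈ Icc (t l - γ) (t l + γ)) (hxt : x ≠ t l) : μ x ≠ m := by
  have hγ := hcrs.gamma_pos
  rw [← hcrs.root l h1 hk]
  intro h
  rcases le_total x (t l) with hle | hle
  · have hinj := (hcrs.mono_left l h1 hk).elim StrictMonoOn.injOn StrictAntiOn.injOn
    exact hxt (hinj ⟨hx.1, hle⟩ ⟨by linarith, le_rfl⟩ h)
  · have hinj := (hcrs.mono_right l h1 hk).elim StrictMonoOn.injOn StrictAntiOn.injOn
    exact hxt (hinj ⟨hle, hx.2⟩ ⟨le_rfl, by linarith⟩ h)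

/-- The contribution of the neighbourhood of a single root, on its own scale. -/
theorem tendsto_setIntegral_root (hcrs : CriticalRootStructure μ m k t v γ) {K : ℝ → ℝ}
    (hKc : Continuous K) (hKe : ∀ x, K (-x) = K x)
    (hKs : Function.support K ⊆ Icc (-1 : ℝ) 1) {l : ℕ} (h1 : 1 ≤ l) (hk : l ≤ k) :
    Tendsto (fun h : ℝ => h ^ (-(1 : ℝ) / ((v l : ℝ) + 1)) *
        ∫ x in Ioc (t l - γ) (t l + γ), K ((μ x - m) / h)) (𝓝[>] 0)
      (𝓝 (((v l + 1).factorial : ℝ) ^ ((1 : ℝ) / ((v l : ℝ) + 1)) *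
        |iteratedDerivWithin (v l + 1) μ (Icc (t l - γ) (t l + γ)) (t l)| ^
          (-(1 : ℝ) / ((v l : ℝ) + 1)) *
        ∫ z in Icc (-1 : ℝ) 1, K (z ^ (v l + 1)))) := by
  obtain ⟨q, hq, hq0, hfq, hqp⟩ := exists_continuousOn_eq_mul_pow (f := fun x => μ x - m)
    hcrs.gamma_pos (v l).succ_ne_zero
    ((hcrs.contDiffOn h1 hk).sub contDiffOn_const)
    (fun j hj => by
      rcases Nat.eq_zero_or_pos j with rfl | hj0
      · simp [hcrs.root l h1 hk]
      · rw [iteratedDerivWithin_sub_const hj0]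
        exact hcrs.deriv_zero l h1 hk j hj0 (Nat.lt_succ_iff.mp hj))
    (by
      rw [iteratedDerivWithin_sub_const (Nat.succ_pos _)]
      exact hcrs.deriv_ne l h1 hk)
    (fun x hx hxt => sub_ne_zero.mpr (hcrs.ne_of_ne_root h1 hk hx hxt))
  have h := tendsto_rpow_mul_setIntegral_comp_div hKc hKe hKs hcrs.gamma_pos
    (v l).succ_ne_zero hq hq0 hfq
  rw [iteratedDerivWithin_sub_const (Nat.succ_pos _)] at hqp
  rw [hqp, abs_mul, Real.mul_rpow (abs_nonneg _) (abs_nonneg _),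
    abs_of_pos (by positivity), Real.inv_rpow (by positivity), neg_div,
    Real.rpow_neg (by positivity), inv_inv, ← neg_div] at h
  simpa only [Nat.succ_eq_add_one, Nat.cast_add, Nat.cast_one] using h

/-- On a coarser scale only roots of the maximal order survive. -/
theorem tendsto_setIntegral_root_of_le (hcrs : CriticalRootStructure μ m k t v γ) {K : ℝ → ℝ}
    (hKc : Continuous K) (hKe : ∀ x, K (-x) = K x)
    (hKs : Function.support K ⊆ Icc (-1 : ℝ) 1) {l : ℕ} (h1 : 1 ≤ l) (hk : l ≤ k) {w : ℕ}
    (hw : v l ≤ w) :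
    Tendsto (fun h : ℝ => h ^ (-(1 : ℝ) / ((w : ℝ) + 1)) *
        ∫ x in Ioc (t l - γ) (t l + γ), K ((μ x - m) / h)) (𝓝[>] 0)
      (𝓝 (if v l = w then ((w + 1).factorial : ℝ) ^ ((1 : ℝ) / ((w : ℝ) + 1)) *
        |iteratedDerivWithin (v l + 1) μ (Icc (t l - γ) (t l + γ)) (t l)| ^
          (-(1 : ℝ) / ((w : ℝ) + 1)) *
        ∫ z in Icc (-1 : ℝ) 1, K (z ^ (w + 1)) else 0)) := by
  have hroot := hcrs.tendsto_setIntegral_root hKc hKe hKs h1 hk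
  rcases hw.eq_or_lt with rfl | hlt
  · simpa using hroot
  · rw [if_neg hlt.ne]
    set e : ℝ := (1 : ℝ) / ((v l : ℝ) + 1) - 1 / ((w : ℝ) + 1) with he
    have he0 : 0 < e := by
      have hlt' : (v l : ℝ) < w := by exact_mod_cast hlt
      exact sub_pos.mpr (one_div_lt_one_div_of_lt (by positivity) (by linarith))
    have hpow : Tendsto (fun h : ℝ => h ^ e) (𝓝[>] 0) (𝓝 0) := by
      have hcont := Real.continuousAt_rpow_const 0 e (Or.inr he0.le)
      rw [ContinuousAt, Real.zero_rpow he0.ne'] at hcont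
      exact hcont.mono_left nhdsWithin_le_nhds
    have hprod := hpow.mul hroot
    rw [zero_mul] at hprod
    refine hprod.congr' (eventually_mem_nhdsWithin.mono fun h hh => ?_)
    rw [← mul_assoc, ← Real.rpow_add hh]
    congr 2
    rw [he]
    ring

theorem setIntegral_eq_sum (hcrs : CriticalRootStructure μ m k t v γ) {K : ℝ → ℝ}
    (hKc : Continuous K) (hKs : Function.support K ⊆ Icc (-1 : ℝ) 1) :
    ∀ᶠ h in 𝓝[>] (0 : ℝ), ∫ x in Icc (0 : ℝ) 1, K ((μ x - m) / h) =
      ∑ l ∈ Finset.Icc 1 k, ∫ x in Ioc (t l - γ) (t l + γ), K ((μ x - m) / h) := by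
  obtain ⟨ε, hε, hsep⟩ := hcrs.sep
  filter_upwards [Ioo_mem_nhdsGT hε] with h hh
  rw [← integral_biUnion_finset]
  · refine setIntegral_eq_of_subset_of_ae_sdiff_eq_zero measurableSet_Icc.nullMeasurableSet
      (iUnion₂_subset fun l hl => ?_) ?_
    · obtain ⟨h1, hk⟩ := Finset.mem_Icc.mp hl
      exact Ioc_subset_Icc_self.trans (hcrs.Icc_subset h1 hk)
    · filter_upwards [(((Finset.Icc 1 k).image fun l => t l - γ).countable_toSet).ae_notMem volume]
        with x hx hmem
      by_contra hne
      have hle := abs_le.mpr (mem_Icc.mp (hKs hne))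
      rw [abs_div, abs_of_pos hh.1, div_le_one hh.1] at hle
      refine absurd (hsep x hmem.1 fun l h1 hk => ?_) (by linarith [hh.2])
      by_contra! hxl
      obtain ⟨ha, hb⟩ := abs_le.mp hxl
      have hl := Finset.mem_Icc.mpr ⟨h1, hk⟩
      refine hmem.2 (mem_iUnion₂.mpr ⟨l, hl, lt_of_le_of_ne (by linarith) fun heq => hx ?_,
        by linarith⟩)
      exact Finset.mem_coe.mpr (Finset.mem_image.mpr ⟨l, hl, heq⟩)
  · exact fun _ _ => measurableSet_Ioc
  · have hdisj : ∀ i ∈ Finset.Icc 1 k, ∀ j ∈ Finset.Icc 1 k, i < j →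
        Disjoint (Ioc (t i - γ) (t i + γ)) (Ioc (t j - γ) (t j + γ)) := fun i hi j hj hij =>
      Set.disjoint_left.mpr fun x hxi hxj => absurd (hcrs.add_gamma_le_sub_gamma
        (Finset.mem_Icc.mp hi).1 hij (Finset.mem_Icc.mp hj).2) (by linarith [hxi.2, hxj.1])
    intro i hi j hj hij
    rcases hij.lt_or_gt with hlt | hlt
    · exact hdisj i hi j hj hlt
    · exact (hdisj j hj i hi hlt).symm
  · intro l hl
    obtain ⟨h1, hk⟩ := Finset.mem_Icc.mp hl
    refine (ContinuousOn.integrableOn_Icc ?_).mono_set Ioc_subset_Icc_self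
    exact hKc.comp_continuousOn
      (((hcrs.contDiffOn h1 hk).continuousOn.sub continuousOn_const).div_const h)

end CriticalRootStructure

/-- equation (B.28): Laplace-type asymptotic of the kernel integral over
`[0,1]`; only roots of maximal order `v` contribute to the limit. -/
theorem level_kernel_integral_asymptotic
    (μ : ℝ → ℝ) (m : ℝ) (k : ℕ) (t : ℕ → ℝ) (v : ℕ → ℕ) (γ : ℝ)
    (hcrs : CriticalRootStructure μ m k t v γ)
    (K_d : ℝ → ℝ) (hKc : Continuous K_d) (hKe : ∀ x, K_d (-x) = K_d x)
    (hKs : Function.support K_d ⊆ Icc (-1 : ℝ) 1) :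
    Tendsto (fun h : ℝ =>
        h ^ (-(1:ℝ) / ((((Finset.Icc 1 k).sup v : ℕ) : ℝ) + 1)) *
          ∫ x in Icc (0:ℝ) 1, K_d ((μ x - m) / h))
      (𝓝[>] 0)
      (𝓝 ((Nat.factorial ((Finset.Icc 1 k).sup v + 1) : ℝ) ^
            ((1:ℝ) / ((((Finset.Icc 1 k).sup v : ℕ) : ℝ) + 1)) *
        (∑ l ∈ (Finset.Icc 1 k).filter (fun l => v l = (Finset.Icc 1 k).sup v),
          |iteratedDerivWithin (v l + 1) μ (Icc (t l - γ) (t l + γ)) (t l)| ^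
            (-(1:ℝ) / ((((Finset.Icc 1 k).sup v : ℕ) : ℝ) + 1))) *
        ∫ z in Icc (-1 : ℝ) 1, K_d (z ^ ((Finset.Icc 1 k).sup v + 1)))) := by
  have hlim := tendsto_finsetSum (Finset.Icc 1 k) fun l hl =>
    hcrs.tendsto_setIntegral_root_of_le hKc hKe hKs (Finset.mem_Icc.mp hl).1
      (Finset.mem_Icc.mp hl).2 (Finset.le_sup (f := v) hl)
  rw [← Finset.sum_filter, ← Finset.sum_mul, ← Finset.mul_sum] at hlim
  refine hlim.congr' ?_
  filter_upwards [hcrs.setIntegral_eq_sum hKc hKs] with h hh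
  rw [hh, Finset.mul_sum]
end

section
/- Suppose (μ, m) has critical root structure with roots 0 < t_1 < … < t_k < 1 of orders v_1, …, v_k, and set v = max_{1 ≤ l ≤ k} v_l. Let σ : [0,1] → ℝ be continuous, let K̄ : ℝ → ℝ be continuous with support contained in [−1,1], and let K_d : ℝ → ℝ be continuous and even with support contained in [−1,1]. Let (b_n) and (h_n) be positive sequences with b_n → 0, n·b_n → ∞ and h_n → 0. Define α̃_n = (1/(n²·b_n²·h_n²)) · Σ_{j=1}^{n} ( ∫_0^1 σ(j/n)·K̄(j/(n·b_n))·K_d((μ(t) − m)/h_n) dt )². Then lim_{n → ∞} n·b_n·h_n^{2v/(v+1)} · α̃_n = σ(0)² · ((v+1)!)^{2/(v+1)} · (∫_0^∞ K̄(t)² dt) · ( Σ_{l : v_l = v} |μ^{(v_l+1)}(t_l)|^{−1/(v+1)} · ∫_{−1}^{1} K_d(z^{v+1}) dz )². -/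
open MeasureTheory Set

open Filter Topology

/-- A root of order `v` of `μ - m` factors out of the neighbourhood of the root, leaving a
continuous non-vanishing cofactor. -/
lemma CriticalRootStructure.exists_factor {μ : ℝ → ℝ} {m : ℝ} {k : ℕ} {t : ℕ → ℝ}
    {v : ℕ → ℕ} {γ : ℝ} (hcrs : CriticalRootStructure μ m k t v γ) (hγ : 0 < γ)
    {l : ℕ} (hl1 : 1 ≤ l) (hlk : l ≤ k) :
    ∃ q : ℝ → ℝ, Continuous q ∧ (∀ x ∈ Icc (t l - γ) (t l + γ), q x ≠ 0) ∧
      q (t l) = iteratedDerivWithin (v l + 1) μ (Icc (t l - γ) (t l + γ)) (t l) /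
        ((v l + 1).factorial : ℝ) ∧
      ∀ x ∈ Icc (t l - γ) (t l + γ), μ x - m = (x - t l) ^ (v l + 1) * q x := by
  set I := Icc (t l - γ) (t l + γ) with hI
  set D := iteratedDerivWithin (v l + 1) μ I (t l) with hD
  have hle : t l - γ ≤ t l + γ := by linarith
  have htI : t l ∈ I := ⟨by linarith, by linarith⟩
  have hroot := hcrs.root l hl1 hlk
  have hcd : ContDiffOn ℝ ((v l + 1 : ℕ) : ℕ∞) μ I := by
    apply contDiffOn_of_continuousOn_differentiableOn_deriv
    · intro j hj
      have hj : j ≤ v l + 1 := by exact_mod_cast hj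
      rcases Nat.lt_or_ge j (v l + 1) with h | h
      · exact (hcrs.diffble l hl1 hlk j (by omega)).continuousOn
      · obtain rfl : j = v l + 1 := by omega
        obtain ⟨C, hC⟩ := hcrs.deriv_lip l hl1 hlk
        exact hC.continuousOn
    · intro j hj
      have hj : j < v l + 1 := by exact_mod_cast hj
      exact hcrs.diffble l hl1 hlk j (by omega)
  have hne : ∀ x ∈ I, x ≠ t l → μ x - m ≠ 0 := by
    intro x hx hxt h0
    have hxm : μ x = μ (t l) := by rw [hroot]; linarith
    apply hxt
    rcases le_total x (t l) with h | h
    · rcases hcrs.mono_left l hl1 hlk with hm | hm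
      · exact hm.injOn ⟨hx.1, h⟩ ⟨htI.1, le_rfl⟩ hxm
      · exact hm.injOn ⟨hx.1, h⟩ ⟨htI.1, le_rfl⟩ hxm
    · rcases hcrs.mono_right l hl1 hlk with hm | hm
      · exact hm.injOn ⟨h, hx.2⟩ ⟨le_rfl, htI.2⟩ hxm
      · exact hm.injOn ⟨h, hx.2⟩ ⟨le_rfl, htI.2⟩ hxm
  have htaylor : ∀ x, taylorWithinEval μ (v l + 1) I (t l) x =
      m + D / ((v l + 1).factorial : ℝ) * (x - t l) ^ (v l + 1) := by
    intro x
    rw [taylor_within_apply, Finset.sum_range_succ, Finset.sum_range_succ',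
      Finset.sum_eq_zero]
    · simp [hroot]
      ring
    · intro j hj
      rw [hcrs.deriv_zero l hl1 hlk (j + 1) (by omega) (by simpa using hj)]
      simp
  have hlim : Tendsto (fun x => (μ x - m) / (x - t l) ^ (v l + 1)) (𝓝[I \ {t l}] (t l))
      (𝓝 (D / ((v l + 1).factorial : ℝ))) := by
    have h1 := (taylor_tendsto (convex_Icc _ _) htI (n := v l + 1) hcd).mono_left
      (nhdsWithin_mono (t l) (sdiff_subset (t := {t l})))
    have h2 := h1.add_const (D / ((v l + 1).factorial : ℝ))
    rw [zero_add] at h2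
    refine h2.congr' ?_
    filter_upwards [self_mem_nhdsWithin] with x hx
    have hx0 : (x - t l) ^ (v l + 1) ≠ 0 := pow_ne_zero _ (sub_ne_zero.2 hx.2)
    rw [htaylor, smul_eq_mul]
    field_simp
    ring
  set q₀ : ℝ → ℝ := Function.update (fun x => (μ x - m) / (x - t l) ^ (v l + 1)) (t l)
    (D / ((v l + 1).factorial : ℝ)) with hq₀
  have hq₀c : ContinuousOn q₀ I := by
    rw [hq₀, continuousOn_update_iff]
    refine ⟨?_, fun _ => hlim⟩
    refine ContinuousOn.div ?_ (by fun_prop) ?_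
    · exact (hcd.continuousOn.mono sdiff_subset).sub continuousOn_const
    · intro x hx
      exact pow_ne_zero _ (sub_ne_zero.2 hx.2)
  have hq₀t : q₀ (t l) = D / ((v l + 1).factorial : ℝ) := by simp [hq₀]
  have hq₀x : ∀ x, x ≠ t l → q₀ x = (μ x - m) / (x - t l) ^ (v l + 1) := by
    intro x hx
    simp [hq₀, hx]
  refine ⟨IccExtend hle (I.domRestrict q₀), ?_, ?_, ?_, ?_⟩
  · exact (continuousOn_iff_continuous_domRestrict.1 hq₀c).Icc_extend'
  · intro x hx
    rw [IccExtend_of_mem _ _ hx, domRestrict_apply]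
    by_cases hxt : x = t l
    · subst hxt
      rw [hq₀t]
      exact div_ne_zero (hcrs.deriv_ne l hl1 hlk) (by positivity)
    · rw [hq₀x x hxt]
      exact div_ne_zero (hne x hx hxt) (pow_ne_zero _ (sub_ne_zero.2 hxt))
  · rw [IccExtend_of_mem _ _ htI, domRestrict_apply, hq₀t]
  · intro x hx
    rw [IccExtend_of_mem _ _ hx, domRestrict_apply]
    by_cases hxt : x = t l
    · subst hxt
      simp [hroot]
    · rw [hq₀x x hxt, mul_div_cancel₀ _ (pow_ne_zero _ (sub_ne_zero.2 hxt))]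

/-- The integral over the line of an even kernel composed with a monomial. -/
lemma integral_even_comp_const_mul_pow {K : ℝ → ℝ} (hKe : ∀ x, K (-x) = K x)
    (hKs : Function.support K ⊆ Icc (-1 : ℝ) 1) {p : ℕ} (hp : p ≠ 0) {a : ℝ} (ha : a ≠ 0) :
    ∫ z, K (z ^ p * a) = |a| ^ (-(1 : ℝ) / p) * ∫ z in Icc (-1 : ℝ) 1, K (z ^ p) := by
  set s : ℝ := |a| ^ ((1 : ℝ) / p) with hs
  have hs0 : 0 < s := Real.rpow_pos_of_pos (abs_pos.2 ha) _
  have hsp : s ^ p = |a| := by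
    rw [hs, one_div, Real.rpow_inv_natCast_pow (abs_nonneg a) hp]
  have h1 : ∀ z, K (z ^ p * a) = K ((s * z) ^ p) := by
    intro z
    rw [mul_pow, hsp]
    rcases abs_choice a with h | h
    · rw [h, mul_comm]
    · rw [h, ← hKe]
      congr 1
      ring
  simp_rw [h1]
  rw [Measure.integral_comp_mul_left (fun z => K (z ^ p)) s,
    abs_of_pos (inv_pos.2 hs0), smul_eq_mul, neg_div, Real.rpow_neg (abs_nonneg a)]
  congr 1
  symm
  apply setIntegral_eq_integral_of_forall_compl_eq_zero
  intro z hz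
  by_contra h0
  apply hz
  have h2 : |z ^ p| ≤ 1 := abs_le.2 (hKs h0)
  rw [abs_pow, pow_le_one_iff_of_nonneg (abs_nonneg z) hp] at h2
  exact abs_le.1 h2

/-- Laplace-type asymptotics of the integral of a kernel localised at a root of order `p`. -/
lemma tendsto_inv_mul_integral_kernel_root {K : ℝ → ℝ} (hKc : Continuous K)
    (hKs : Function.support K ⊆ Icc (-1 : ℝ) 1) {p : ℕ} (hp : p ≠ 0) {c γ : ℝ} (hγ : 0 < γ)
    {q : ℝ → ℝ} (hqc : Continuous q) (hq : ∀ x ∈ Icc (c - γ) (c + γ), q x ≠ 0) :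
    Tendsto (fun r : ℝ => r⁻¹ * ∫ x in Icc (c - γ) (c + γ), K ((x - c) ^ p * q x / r ^ p))
      (𝓝[>] 0) (𝓝 (∫ z, K (z ^ p * q c))) := by
  set I := Icc (c - γ) (c + γ) with hI
  have hcI : c ∈ I := ⟨by linarith, by linarith⟩
  set F : ℝ → ℝ → ℝ := fun r z =>
    I.indicator (fun x => K ((x - c) ^ p * q x / r ^ p)) (c + r * z) with hF
  have hFint : ∀ r > 0, ∫ z, F r z = r⁻¹ * ∫ x in I, K ((x - c) ^ p * q x / r ^ p) := by
    intro r hr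
    set G := I.indicator (fun x => K ((x - c) ^ p * q x / r ^ p))
    rw [← integral_indicator measurableSet_Icc, ← integral_add_left_eq_self G c]
    simp only [hF]
    rw [Measure.integral_comp_mul_left (fun z => G (c + z)) r, abs_of_pos (inv_pos.2 hr),
      smul_eq_mul]
  obtain ⟨x₀, hx₀, hmin⟩ := isCompact_Icc.exists_isMinOn ⟨c, hcI⟩ (hqc.abs.continuousOn (s := I))
  set d := |q x₀| with hd
  have hd0 : 0 < d := abs_pos.2 (hq x₀ hx₀)
  have hdq : ∀ x ∈ I, d ≤ |q x| := fun x hx => hmin hx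
  obtain ⟨M, hM⟩ := hKc.bounded_above_of_compact_support
    (HasCompactSupport.of_support_subset_isCompact isCompact_Icc hKs)
  set R := max 1 (1 / d) with hR
  have hM0 : 0 ≤ M := (norm_nonneg _).trans (hM 0)
  have hFv : ∀ r > 0, ∀ z, c + r * z ∈ I → F r z = K (z ^ p * q (c + r * z)) := by
    intro r hr z hz
    simp only [hF]
    rw [indicator_of_mem hz]
    congr 1
    have : r ^ p ≠ 0 := pow_ne_zero _ hr.ne'
    field_simp
    ring
  have hlim : Tendsto (fun r => ∫ z, F r z) (𝓝[>] 0) (𝓝 (∫ z, K (z ^ p * q c))) := by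
    refine tendsto_integral_filter_of_dominated_convergence
      ((Icc (-R) R).indicator fun _ => M) ?_ ?_ ?_ ?_
    · refine Eventually.of_forall fun r => Measurable.aestronglyMeasurable ?_
      have h1 : Measurable (I.indicator (fun x => K ((x - c) ^ p * q x / r ^ p))) :=
        Measurable.indicator (Continuous.measurable (by fun_prop)) measurableSet_Icc
      exact h1.comp (by fun_prop)
    · filter_upwards [self_mem_nhdsWithin] with r hr
      refine Eventually.of_forall fun z => ?_
      by_cases hz : z ∈ Icc (-R) R
      · rw [indicator_of_mem hz]
        simp only [hF, indicator]
        split_ifs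
        · exact hM _
        · simpa using hM0
      · rw [indicator_of_notMem hz]
        by_cases hzI : c + r * z ∈ I
        · rw [hFv r hr z hzI]
          have hzR : R < |z| := by
            by_contra h0
            exact hz (abs_le.1 (not_lt.1 h0))
          have hz1 : 1 ≤ |z| := (le_max_left _ _).trans hzR.le
          have hz2 : 1 / d < |z| := (le_max_right _ _).trans_lt hzR
          have hz3 : |z| ≤ |z| ^ p := le_self_pow₀ hz1 hp
          have h4 : 1 < |z ^ p * q (c + r * z)| := by
            rw [abs_mul, abs_pow]
            calc 1 = 1 / d * d := by field_simp
              _ < |z| * d := by gcongr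
              _ ≤ |z| ^ p * |q (c + r * z)| := by
                gcongr
                exact hdq _ hzI
          have h5 : K (z ^ p * q (c + r * z)) = 0 := by
            by_contra h0
            exact absurd (abs_le.2 (hKs h0)) (not_le.2 h4)
          simp [h5]
        · simp [hF, hzI]
    · exact (integrable_indicator_iff measurableSet_Icc).2 (integrableOn_const (by simp))
    · refine Eventually.of_forall fun z => ?_
      have hcont : Tendsto (fun r : ℝ => c + r * z) (𝓝[>] 0) (𝓝 c) := by
        have : Continuous (fun r : ℝ => c + r * z) := by fun_prop
        have h := this.tendsto 0
        simp only [zero_mul, add_zero] at h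
        exact h.mono_left nhdsWithin_le_nhds
      have hIn : I ∈ 𝓝 c := Icc_mem_nhds (by linarith) (by linarith)
      have hK : Tendsto (fun r : ℝ => K (z ^ p * q (c + r * z))) (𝓝[>] 0)
          (𝓝 (K (z ^ p * q c))) := by
        have : Continuous (fun x => K (z ^ p * q x)) := by fun_prop
        exact (this.tendsto c).comp hcont
      refine hK.congr' ?_
      filter_upwards [self_mem_nhdsWithin, hcont hIn] with r hr hrI
      exact (hFv r hr z hrI).symm
  refine hlim.congr' ?_
  filter_upwards [self_mem_nhdsWithin] with r hr
  exact hFint r hr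

/-- Riemann sums at the left boundary point, with a localising kernel of vanishing bandwidth. -/
lemma tendsto_boundary_riemann_sum {σ : ℝ → ℝ} (hσ : ContinuousOn σ (Icc 0 1))
    {K : ℝ → ℝ} (hKc : Continuous K) (hKs : Function.support K ⊆ Icc (-1 : ℝ) 1)
    {b : ℕ → ℝ} (hbpos : ∀ n, 0 < b n) (hb0 : Tendsto b atTop (𝓝 0))
    (hnb : Tendsto (fun n : ℕ => (n : ℝ) * b n) atTop atTop) :
    Tendsto (fun n : ℕ => ((n : ℝ) * b n)⁻¹ * ∑ j ∈ Finset.Icc 1 n,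
        (σ ((j : ℝ) / n) * K ((j : ℝ) / (n * b n))) ^ 2)
      atTop (𝓝 (σ 0 ^ 2 * ∫ x in Ioi (0 : ℝ), K x ^ 2)) := by
  set g : ℕ → ℕ → ℝ := fun n j => (σ ((j : ℝ) / n) * K ((j : ℝ) / (n * b n))) ^ 2 with hg
  set F : ℕ → ℝ → ℝ := fun n =>
    (Ioc 0 ((n : ℝ) / (n * b n))).indicator fun x => g n ⌈x * (n * b n)⌉₊ with hF
  have hFint : ∀ᶠ n : ℕ in atTop, ∫ x in Ioi (0 : ℝ), F n x =
      ((n : ℝ) * b n)⁻¹ * ∑ j ∈ Finset.Icc 1 n, g n j := by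
    filter_upwards [hnb.eventually_gt_atTop 0] with n hN
    set N := (n : ℝ) * b n with hNdef
    have hconst : ∀ j : ℕ, ∀ x ∈ Ioc ((j : ℝ) / N) (((j + 1 : ℕ) : ℝ) / N),
        g n ⌈x * N⌉₊ = g n (j + 1) := by
      intro j x hx
      congr 1
      rw [Nat.ceil_eq_iff (by omega)]
      refine ⟨?_, (le_div_iff₀ hN).1 hx.2⟩
      simpa using (div_lt_iff₀ hN).1 hx.1
    have hle : ∀ j : ℕ, (j : ℝ) / N ≤ ((j + 1 : ℕ) : ℝ) / N := by
      intro j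
      gcongr
      omega
    have hpiece : ∀ j : ℕ, ∫ x in ((j : ℝ) / N)..(((j + 1 : ℕ) : ℝ) / N), g n ⌈x * N⌉₊ =
        N⁻¹ * g n (j + 1) := by
      intro j
      rw [intervalIntegral.integral_of_le (hle j),
        setIntegral_congr_fun measurableSet_Ioc (hconst j),
        ← intervalIntegral.integral_of_le (hle j), intervalIntegral.integral_const, smul_eq_mul]
      push_cast
      field_simp
      ring
    have hintv : ∀ j : ℕ, IntervalIntegrable (fun x => g n ⌈x * N⌉₊) volume
        ((j : ℝ) / N) (((j + 1 : ℕ) : ℝ) / N) := by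
      intro j
      rw [intervalIntegrable_iff_integrableOn_Ioc_of_le (hle j)]
      exact (integrableOn_const (C := g n (j + 1)) (by simp)).congr_fun
        (fun x hx => (hconst j x hx).symm) measurableSet_Ioc
    have hsum := intervalIntegral.sum_integral_adjacent_intervals (μ := volume)
      (f := fun x => g n ⌈x * N⌉₊) (a := fun j : ℕ => (j : ℝ) / N) (n := n)
      (fun j _ => hintv j)
    simp only [hpiece] at hsum
    rw [setIntegral_indicator measurableSet_Ioc,
      inter_eq_right.2 (fun x hx => hx.1), ← intervalIntegral.integral_of_le (by positivity)]
    rw [Nat.cast_zero, zero_div] at hsum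
    rw [← hsum, ← Finset.mul_sum, Finset.range_eq_Ico, Finset.sum_Ico_add' (g n) 0 n 1, zero_add,
      Finset.Ico_add_one_right_eq_Icc]
  obtain ⟨S, hS⟩ := isCompact_Icc.exists_bound_of_continuousOn hσ
  obtain ⟨M, hM⟩ := hKc.bounded_above_of_compact_support
    (HasCompactSupport.of_support_subset_isCompact isCompact_Icc hKs)
  have hS0 : 0 ≤ S := (norm_nonneg _).trans (hS 0 (by simp))
  have hlim : Tendsto (fun n => ∫ x in Ioi (0 : ℝ), F n x) atTop
      (𝓝 (∫ x in Ioi (0 : ℝ), (σ 0 * K x) ^ 2)) := by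
    refine tendsto_integral_filter_of_dominated_convergence
      ((Icc (0 : ℝ) 1).indicator fun _ => (S * M) ^ 2) ?_ ?_ ?_ ?_
    · refine Eventually.of_forall fun n => Measurable.aestronglyMeasurable ?_
      refine Measurable.indicator ?_ measurableSet_Ioc
      exact (measurable_from_top (f := g n)).comp
        (Nat.measurable_ceil.comp (measurable_id.mul_const _))
    · filter_upwards [hnb.eventually_gt_atTop 0] with n hN
      refine (ae_restrict_mem measurableSet_Ioi).mono fun x hx => ?_
      have hx : 0 < x := hx
      simp only [hF]
      by_cases hxn : x ∈ Ioc 0 ((n : ℝ) / (n * b n))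
      · rw [indicator_of_mem hxn]
        have hxN : x ≤ (⌈x * (n * b n)⌉₊ : ℝ) / (n * b n) :=
          (le_div_iff₀ hN).2 (Nat.le_ceil _)
        by_cases hx1 : x ∈ Icc (0 : ℝ) 1
        · rw [indicator_of_mem hx1]
          have hceil : ⌈x * (n * b n)⌉₊ ≤ n := Nat.ceil_le.2 ((le_div_iff₀ hN).1 hxn.2)
          have hm : (⌈x * (n * b n)⌉₊ : ℝ) / n ∈ Icc (0 : ℝ) 1 :=
            ⟨by positivity, div_le_one_of_le₀ (by exact_mod_cast hceil) (by positivity)⟩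
          simp only [hg, norm_pow, norm_mul]
          gcongr
          · exact hS _ hm
          · exact hM _
        · have h0 : K ((⌈x * (n * b n)⌉₊ : ℝ) / (n * b n)) = 0 := by
            by_contra h0
            exact hx1 ⟨hx.le, hxN.trans (hKs h0).2⟩
          simp [hg, h0, hx1]
      · rw [indicator_of_notMem hxn, norm_zero]
        exact indicator_nonneg (fun _ _ => by positivity) _
    · exact ((integrable_indicator_iff measurableSet_Icc).2
        (integrableOn_const (by simp))).restrict
    · refine (ae_restrict_mem measurableSet_Ioi).mono fun x hx => ?_
      have hx : 0 < x := hx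
      have h1 : Tendsto (fun n : ℕ => (⌈x * (n * b n)⌉₊ : ℝ) / (n * b n)) atTop (𝓝 x) :=
        (tendsto_nat_ceil_mul_div_atTop hx.le).comp hnb
      have h2 : Tendsto (fun n : ℕ => (⌈x * (n * b n)⌉₊ : ℝ) / n) atTop (𝓝 0) := by
        have h := h1.mul hb0
        rw [mul_zero] at h
        refine h.congr fun n => ?_
        have := (hbpos n).ne'
        field_simp
      have hbx : ∀ᶠ n in atTop, b n * x < 1 := by
        have h := hb0.mul_const x
        rw [zero_mul] at h
        exact h.eventually_lt_const one_pos
      have hin : ∀ᶠ n : ℕ in atTop, x ∈ Ioc 0 ((n : ℝ) / (n * b n)) := by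
        filter_upwards [hbx, hnb.eventually_gt_atTop 0] with n hn hN
        refine ⟨hx, (le_div_iff₀ hN).2 ?_⟩
        nlinarith [Nat.cast_nonneg (α := ℝ) n]
      have h3 : Tendsto (fun n : ℕ => σ ((⌈x * (n * b n)⌉₊ : ℝ) / n)) atTop (𝓝 (σ 0)) := by
        refine (hσ 0 (by simp)).tendsto.comp (tendsto_nhdsWithin_iff.2 ⟨h2, ?_⟩)
        filter_upwards [h2.eventually_le_const one_pos] with n hn
        exact ⟨by positivity, hn⟩
      have h4 := (h3.mul ((hKc.tendsto x).comp h1)).pow 2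
      refine h4.congr' ?_
      filter_upwards [hin] with n hn
      simp only [hF]
      rw [indicator_of_mem hn]
      rfl
  rw [← integral_const_mul]
  simp_rw [mul_pow] at hlim
  exact hlim.congr' hFint

lemma CriticalRootStructure.two_mul_gamma_le_s15 {μ : ℝ → ℝ} {m : ℝ} {k : ℕ} {t : ℕ → ℝ}
    {v : ℕ → ℕ} {γ : ℝ} (hcrs : CriticalRootStructure μ m k t v γ) {i : ℕ} (hi : i ≤ k) :
    2 * γ ≤ extRoots k t (i + 1) - extRoots k t i := by
  rw [hcrs.gamma_eq]
  have := Finset.inf'_le (s := Finset.Icc 0 k)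
    (fun i => extRoots k t (i + 1) - extRoots k t i) (Finset.mem_Icc.2 ⟨Nat.zero_le i, hi⟩)
  linarith

lemma CriticalRootStructure.gamma_pos_s15 {μ : ℝ → ℝ} {m : ℝ} {k : ℕ} {t : ℕ → ℝ}
    {v : ℕ → ℕ} {γ : ℝ} (hcrs : CriticalRootStructure μ m k t v γ) : 0 < γ := by
  rw [hcrs.gamma_eq]
  refine mul_pos (by norm_num) ((Finset.lt_inf'_iff _).2 fun i hi => ?_)
  have hik : i ≤ k := (Finset.mem_Icc.1 hi).2
  have hk := hcrs.k_pos
  have h1 := hcrs.first_pos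
  have h2 := hcrs.last_lt
  rcases Nat.eq_zero_or_pos i with rfl | hi0
  · have : 1 ≤ k := hk
    simpa [extRoots, this] using h1
  · rcases hik.lt_or_eq with h | rfl
    · have := hcrs.mono i (i + 1) hi0 (by omega) h
      have h' : i + 1 ≤ k := h
      simpa [extRoots, hi0.ne', hik, h'] using this
    · simpa [extRoots, hi0.ne'] using h2

lemma CriticalRootStructure.add_two_mul_gamma_le {μ : ℝ → ℝ} {m : ℝ} {k : ℕ} {t : ℕ → ℝ}
    {v : ℕ → ℕ} {γ : ℝ} (hcrs : CriticalRootStructure μ m k t v γ) {i j : ℕ} (hi : 1 ≤ i)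
    (hij : i < j) (hj : j ≤ k) : t i + 2 * γ ≤ t j := by
  have h := hcrs.two_mul_gamma_le_s15 (i := i) (by omega)
  have hle : t (i + 1) ≤ t j := by
    rcases (Nat.succ_le_of_lt hij).lt_or_eq with h' | h'
    · exact (hcrs.mono (i + 1) j (by omega) h' hj).le
    · exact h' ▸ le_rfl
  have h1 : i ≠ 0 := by omega
  have h2 : i ≤ k := by omega
  have h3 : i + 1 ≤ k := by omega
  simp only [extRoots, h1, h2, h3, if_true, if_false, Nat.add_eq_zero_iff, one_ne_zero,
    and_false] at h
  linarith

lemma CriticalRootStructure.Icc_subset_s15 {μ : ℝ → ℝ} {m : ℝ} {k : ℕ} {t : ℕ → ℝ}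
    {v : ℕ → ℕ} {γ : ℝ} (hcrs : CriticalRootStructure μ m k t v γ) {l : ℕ} (hl1 : 1 ≤ l)
    (hlk : l ≤ k) : Icc (t l - γ) (t l + γ) ⊆ Icc 0 1 := by
  have hγ := hcrs.gamma_pos_s15
  have hk : 1 ≤ k := hcrs.k_pos
  have h0 := hcrs.two_mul_gamma_le_s15 (Nat.zero_le k)
  have h1 := hcrs.two_mul_gamma_le_s15 (le_refl k)
  simp only [extRoots, hk, zero_add, if_true, if_false, one_ne_zero] at h0
  have hk0 : k ≠ 0 := by omega
  simp only [extRoots, hk0, le_refl, if_true, if_false, Nat.add_eq_zero_iff, one_ne_zero,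
    and_false, Nat.not_succ_le_self] at h1
  have h2 : t 1 ≤ t l := by
    rcases hl1.lt_or_eq with h | rfl
    · exact (hcrs.mono 1 l le_rfl h hlk).le
    · exact le_rfl
  have h3 : t l ≤ t k := by
    rcases hlk.lt_or_eq with h | rfl
    · exact (hcrs.mono l k hl1 h le_rfl).le
    · exact le_rfl
  exact Icc_subset_Icc (by linarith) (by linarith)

/-- The critical neighbourhoods carry the whole integral once the bandwidth is small. -/
lemma CriticalRootStructure.eventually_integral_eq_sum {μ : ℝ → ℝ} {m : ℝ} {k : ℕ} {t : ℕ → ℝ}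
    {v : ℕ → ℕ} {γ : ℝ} (hcrs : CriticalRootStructure μ m k t v γ)
    {K : ℝ → ℝ} (hKc : Continuous K) (hKs : Function.support K ⊆ Icc (-1 : ℝ) 1) :
    ∀ᶠ h in 𝓝[>] (0 : ℝ), ∫ x in Icc (0 : ℝ) 1, K ((μ x - m) / h) =
      ∑ l ∈ Finset.Icc 1 k, ∫ x in Icc (t l - γ) (t l + γ), K ((μ x - m) / h) := by
  obtain ⟨ε, hε, hsep⟩ := hcrs.sep
  have hγ := hcrs.gamma_pos_s15
  filter_upwards [self_mem_nhdsWithin, nhdsWithin_le_nhds (Iio_mem_nhds hε)] with h hh hhε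
  have hh : 0 < h := hh
  have hhε : h < ε := hhε
  simp_rw [integral_Icc_eq_integral_Ioo (μ := volume) (x := t _ - γ)]
  rw [← integral_biUnion_finset]
  · refine setIntegral_eq_of_subset_of_ae_sdiff_eq_zero nullMeasurableSet_Icc ?_ ?_
    · refine iUnion₂_subset fun l hl => ?_
      rw [Finset.mem_Icc] at hl
      exact Ioo_subset_Icc_self.trans (hcrs.Icc_subset_s15 hl.1 hl.2)
    · have hae : ∀ᵐ x : ℝ, ∀ l : ℕ, x ≠ t l - γ ∧ x ≠ t l + γ :=
        ae_all_iff.2 fun l => (Measure.ae_ne volume _).and (Measure.ae_ne volume _)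
      filter_upwards [hae] with x hx hxd
      have hge : ε ≤ |μ x - m| := by
        refine hsep x hxd.1 fun l hl1 hlk => ?_
        by_contra hcon
        have hcon := abs_le.1 (not_lt.1 hcon)
        refine hxd.2 (mem_iUnion₂.2 ⟨l, Finset.mem_Icc.2 ⟨hl1, hlk⟩, ?_, ?_⟩)
        · exact lt_of_le_of_ne (by linarith [hcon.1]) (hx l).1.symm
        · exact lt_of_le_of_ne (by linarith [hcon.2]) (hx l).2
      by_contra h0
      have h1 := abs_le.2 (hKs h0)
      rw [abs_div, abs_of_pos hh, div_le_one hh] at h1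
      linarith
  · exact fun _ _ => measurableSet_Ioo
  · have key : ∀ i j, 1 ≤ i → i < j → j ≤ k →
        Disjoint (Ioo (t i - γ) (t i + γ)) (Ioo (t j - γ) (t j + γ)) := by
      intro i j hi hij hj
      rw [Set.disjoint_left]
      intro x hx hx'
      have := hcrs.add_two_mul_gamma_le hi hij hj
      linarith [hx.2, hx'.1]
    intro i hi j hj hij
    simp only [Finset.coe_Icc, mem_Icc] at hi hj
    rcases lt_or_gt_of_ne hij with h' | h'
    · exact key i j hi.1 h' hj.2
    · exact (key j i hj.1 h' hi.2).symm
  · intro l hl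
    rw [Finset.mem_Icc] at hl
    have hμ : ContinuousOn μ (Icc (t l - γ) (t l + γ)) := by
      simpa using (hcrs.diffble l hl.1 hl.2 0 (Nat.zero_le _)).continuousOn
    refine IntegrableOn.mono_set (ContinuousOn.integrableOn_Icc ?_) Ioo_subset_Icc_self
    exact hKc.comp_continuousOn ((hμ.sub continuousOn_const).div_const h)

/-- Contribution of one critical root, normalised at its own order. -/
lemma CriticalRootStructure.tendsto_local_integral {μ : ℝ → ℝ} {m : ℝ} {k : ℕ} {t : ℕ → ℝ}
    {v : ℕ → ℕ} {γ : ℝ} (hcrs : CriticalRootStructure μ m k t v γ)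
    {K : ℝ → ℝ} (hKc : Continuous K) (hKe : ∀ x, K (-x) = K x)
    (hKs : Function.support K ⊆ Icc (-1 : ℝ) 1) {l : ℕ} (hl1 : 1 ≤ l) (hlk : l ≤ k) :
    Tendsto (fun h : ℝ => h ^ (-(1 : ℝ) / ((v l : ℝ) + 1)) *
        ∫ x in Icc (t l - γ) (t l + γ), K ((μ x - m) / h)) (𝓝[>] 0)
      (𝓝 (((v l + 1).factorial : ℝ) ^ ((1 : ℝ) / ((v l : ℝ) + 1)) *
        (|iteratedDerivWithin (v l + 1) μ (Icc (t l - γ) (t l + γ)) (t l)| ^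
          (-(1 : ℝ) / ((v l : ℝ) + 1)) * ∫ z in Icc (-1 : ℝ) 1, K (z ^ (v l + 1))))) := by
  have hγ := hcrs.gamma_pos_s15
  obtain ⟨q, hqc, hq0, hqt, hqf⟩ := hcrs.exists_factor hγ hl1 hlk
  have htI : t l ∈ Icc (t l - γ) (t l + γ) := ⟨by linarith, by linarith⟩
  have hlim := tendsto_inv_mul_integral_kernel_root hKc hKs (Nat.succ_ne_zero (v l)) hγ hqc hq0
  have hp0 : (0 : ℝ) < (v l : ℝ) + 1 := by positivity
  have hroot : Tendsto (fun h : ℝ => h ^ ((1 : ℝ) / ((v l : ℝ) + 1))) (𝓝[>] 0) (𝓝[>] 0) := by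
    refine tendsto_nhdsWithin_iff.2 ⟨?_, ?_⟩
    · have h := (Real.continuousAt_rpow_const 0 ((1 : ℝ) / ((v l : ℝ) + 1))
        (Or.inr (by positivity))).tendsto
      rw [Real.zero_rpow (by positivity)] at h
      exact h.mono_left nhdsWithin_le_nhds
    · filter_upwards [self_mem_nhdsWithin] with h hh
      exact Real.rpow_pos_of_pos hh _
  have hlim := hlim.comp hroot
  rw [integral_even_comp_const_mul_pow hKe hKs (Nat.succ_ne_zero (v l)) (hq0 _ htI), hqt,
    abs_div, Nat.abs_cast, Real.div_rpow (abs_nonneg _) (by positivity)] at hlim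
  have hval : ∀ A B : ℝ, A / ((v l + 1).factorial : ℝ) ^ (-(1 : ℝ) / ((v l + 1 : ℕ) : ℝ)) * B =
      ((v l + 1).factorial : ℝ) ^ ((1 : ℝ) / ((v l : ℝ) + 1)) * (A * B) := by
    intro A B
    rw [neg_div, Real.rpow_neg (by positivity), div_inv_eq_mul]
    push_cast
    ring
  rw [Nat.succ_eq_add_one, hval] at hlim
  push_cast at hlim
  refine hlim.congr' ?_
  filter_upwards [self_mem_nhdsWithin] with h hh
  have hh : 0 < h := hh
  simp only [Function.comp_apply]
  rw [neg_div, Real.rpow_neg hh.le]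
  congr 1
  refine setIntegral_congr_fun measurableSet_Icc fun x hx => ?_
  have hpow : (h ^ ((1 : ℝ) / ((v l : ℝ) + 1))) ^ (v l + 1) = h := by
    have := Real.rpow_inv_natCast_pow hh.le (Nat.succ_ne_zero (v l))
    rw [one_div]
    simpa using this
  simp only [hpow, hqf x hx]

/-- Contribution of one critical root, normalised at an order at least its own. -/
lemma CriticalRootStructure.tendsto_local_integral_of_le {μ : ℝ → ℝ} {m : ℝ} {k : ℕ}
    {t : ℕ → ℝ} {v : ℕ → ℕ} {γ : ℝ} (hcrs : CriticalRootStructure μ m k t v γ)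
    {K : ℝ → ℝ} (hKc : Continuous K) (hKe : ∀ x, K (-x) = K x)
    (hKs : Function.support K ⊆ Icc (-1 : ℝ) 1) {l : ℕ} (hl1 : 1 ≤ l) (hlk : l ≤ k)
    {w : ℕ} (hw : v l ≤ w) :
    Tendsto (fun h : ℝ => h ^ (-(1 : ℝ) / ((w : ℝ) + 1)) *
        ∫ x in Icc (t l - γ) (t l + γ), K ((μ x - m) / h)) (𝓝[>] 0)
      (𝓝 (if v l = w then ((w + 1).factorial : ℝ) ^ ((1 : ℝ) / ((w : ℝ) + 1)) *
        (|iteratedDerivWithin (v l + 1) μ (Icc (t l - γ) (t l + γ)) (t l)| ^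
          (-(1 : ℝ) / ((w : ℝ) + 1)) * ∫ z in Icc (-1 : ℝ) 1, K (z ^ (w + 1))) else 0)) := by
  have hlim := hcrs.tendsto_local_integral hKc hKe hKs hl1 hlk
  split_ifs with hvw
  · subst hvw
    exact hlim
  · have hlt : (v l : ℝ) < w := by exact_mod_cast lt_of_le_of_ne hw hvw
    set e : ℝ := 1 / ((v l : ℝ) + 1) - 1 / ((w : ℝ) + 1) with he
    have he0 : 0 < e := sub_pos.2 (one_div_lt_one_div_of_lt (by positivity) (by linarith))
    have hpow : Tendsto (fun h : ℝ => h ^ e) (𝓝[>] 0) (𝓝 0) := by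
      have h := (Real.continuousAt_rpow_const 0 e (Or.inr he0.le)).tendsto
      rw [Real.zero_rpow he0.ne'] at h
      exact h.mono_left nhdsWithin_le_nhds
    have hprod := hpow.mul hlim
    rw [zero_mul] at hprod
    refine hprod.congr' ?_
    filter_upwards [self_mem_nhdsWithin] with h hh
    have hh : 0 < h := hh
    rw [← mul_assoc, ← Real.rpow_add hh]
    congr 2
    rw [he]
    ring

/-- assertion (B.2) with (B.29)–(B.30): limit of the boundary variance
component `α̃_n` of the Gaussian approximation. -/
theorem boundary_variance_component_limit
    (μ : ℝ → ℝ) (m : ℝ) (k : ℕ) (t : ℕ → ℝ) (v : ℕ → ℕ) (γ : ℝ)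
    (hcrs : CriticalRootStructure μ m k t v γ)
    (σ : ℝ → ℝ) (hσ : ContinuousOn σ (Icc 0 1))
    (Kbar : ℝ → ℝ) (hKbc : Continuous Kbar)
    (hKbs : Function.support Kbar ⊆ Icc (-1 : ℝ) 1)
    (K_d : ℝ → ℝ) (hKdc : Continuous K_d) (hKde : ∀ x, K_d (-x) = K_d x)
    (hKds : Function.support K_d ⊆ Icc (-1 : ℝ) 1)
    (b h : ℕ → ℝ) (hbpos : ∀ n, 0 < b n) (hhpos : ∀ n, 0 < h n)
    (hb0 : Tendsto b atTop (𝓝 0))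
    (hnb : Tendsto (fun n : ℕ => (n:ℝ) * b n) atTop atTop)
    (hh0 : Tendsto h atTop (𝓝 0)) :
    Tendsto (fun n : ℕ =>
        (n:ℝ) * b n *
          (h n) ^ ((2 * (((Finset.Icc 1 k).sup v : ℕ) : ℝ)) /
            ((((Finset.Icc 1 k).sup v : ℕ) : ℝ) + 1)) *
        ((1 / ((n:ℝ)^2 * (b n)^2 * (h n)^2)) *
          ∑ j ∈ Finset.Icc 1 n,
            (∫ x in Icc (0:ℝ) 1,
              σ ((j:ℝ) / (n:ℝ)) * Kbar ((j:ℝ) / ((n:ℝ) * b n)) *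
                K_d ((μ x - m) / h n))^2))
      atTop
      (𝓝 ((σ 0)^2 *
        (Nat.factorial ((Finset.Icc 1 k).sup v + 1) : ℝ) ^
          ((2:ℝ) / ((((Finset.Icc 1 k).sup v : ℕ) : ℝ) + 1)) *
        (∫ x in Ioi (0:ℝ), (Kbar x)^2) *
        (∑ l ∈ (Finset.Icc 1 k).filter (fun l => v l = (Finset.Icc 1 k).sup v),
          |iteratedDerivWithin (v l + 1) μ (Icc (t l - γ) (t l + γ)) (t l)| ^
              (-(1:ℝ) / ((((Finset.Icc 1 k).sup v : ℕ) : ℝ) + 1)) *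
            ∫ z in Icc (-1 : ℝ) 1, K_d (z ^ ((Finset.Icc 1 k).sup v + 1)))^2)) := by
  set w := (Finset.Icc 1 k).sup v with hw
  have hh : Tendsto h atTop (𝓝[>] 0) :=
    tendsto_nhdsWithin_iff.2 ⟨hh0, Eventually.of_forall hhpos⟩
  have hsum : Tendsto (fun n => h n ^ (-(1 : ℝ) / ((w : ℝ) + 1)) *
      ∫ x in Icc (0 : ℝ) 1, K_d ((μ x - m) / h n)) atTop
      (𝓝 (((w + 1).factorial : ℝ) ^ ((1 : ℝ) / ((w : ℝ) + 1)) *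
        ∑ l ∈ (Finset.Icc 1 k).filter (fun l => v l = w),
          |iteratedDerivWithin (v l + 1) μ (Icc (t l - γ) (t l + γ)) (t l)| ^
              (-(1 : ℝ) / ((w : ℝ) + 1)) *
            ∫ z in Icc (-1 : ℝ) 1, K_d (z ^ (w + 1)))) := by
    have hlim := tendsto_finsetSum (Finset.Icc 1 k) fun l hl =>
      (hcrs.tendsto_local_integral_of_le hKdc hKde hKds (Finset.mem_Icc.1 hl).1
        (Finset.mem_Icc.1 hl).2 (Finset.le_sup (f := v) hl)).comp hh
    rw [← hw, ← Finset.sum_filter, ← Finset.mul_sum] at hlim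
    refine hlim.congr' ?_
    filter_upwards [hh.eventually (hcrs.eventually_integral_eq_sum hKdc hKds)] with n hn
    rw [hn, Finset.mul_sum]
    rfl
  have hlim := (tendsto_boundary_riemann_sum hσ hKbc hKbs hbpos hb0 hnb).mul (hsum.pow 2)
  have hval : ∀ A B S : ℝ,
      A * B * (((w + 1).factorial : ℝ) ^ ((1 : ℝ) / ((w : ℝ) + 1)) * S) ^ 2 =
      A * ((w + 1).factorial : ℝ) ^ ((2 : ℝ) / ((w : ℝ) + 1)) * B * S ^ 2 := by
    intro A B S
    have h2 : ((w + 1).factorial : ℝ) ^ ((2 : ℝ) / ((w : ℝ) + 1)) =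
        (((w + 1).factorial : ℝ) ^ ((1 : ℝ) / ((w : ℝ) + 1))) ^ 2 := by
      rw [← Real.rpow_mul_natCast (by positivity)]
      congr 1
      push_cast
      ring
    rw [h2]
    ring
  rw [hval] at hlim
  refine hlim.congr' ?_
  filter_upwards [hnb.eventually_gt_atTop 0] with n hN
  have hn0 : (n : ℝ) ≠ 0 := left_ne_zero_of_mul hN.ne'
  have hb := (hbpos n).ne'
  have hhn := hhpos n
  have hexp : h n ^ ((2 * (w : ℝ)) / ((w : ℝ) + 1)) =
      h n ^ 2 * (h n ^ (-(1 : ℝ) / ((w : ℝ) + 1))) ^ 2 := by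
    rw [← Real.rpow_mul_natCast hhn.le, ← Real.rpow_natCast (h n) 2, ← Real.rpow_add hhn]
    congr 1
    push_cast
    field_simp
    ring
  simp_rw [integral_const_mul, mul_pow _ (∫ x in Icc (0 : ℝ) 1, K_d ((μ x - m) / h n))]
  rw [← Finset.sum_mul, hexp]
  have := hhn.ne'
  field_simp
end
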